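/- Let n ≥ 1, let Ω be a real (2n+1) × (2n+1) antisymmetric matrix (Ωᵀ = −Ω) of rank 2n, and let A be a real (2n+1) × (2n+1) matrix with det A = 1 and Aᵀ Ω A = Ω. Then A v = v for every vector v ∈ ℝ^{2n+1} with Ω v = 0; in particular, 1 is an eigenvalue of A. -/

import Mathlib

open Matrix

lemma sum_gram_det_ne {ι : Type*} [Fintype ι] [DecidableEq ι]
    (X Y : Matrix ι ι ℝ) (h : ∀ w, Xᵀ *ᵥ w = 0 → Yᵀ *ᵥ w = 0 → w = 0) :
    (X * Xᵀ + Y * Yᵀ).det ≠ 0 := by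
  intro h0
  obtain ⟨w, hw, hw0⟩ := Matrix.exists_mulVec_eq_zero_iff.mpr h0
  apply hw
  have key : (Xᵀ *ᵥ w) ⬝ᵥ (Xᵀ *ᵥ w) + (Yᵀ *ᵥ w) ⬝ᵥ (Yᵀ *ᵥ w) = 0 := by
    have h1 : w ⬝ᵥ ((X * Xᵀ + Y * Yᵀ) *ᵥ w) = 0 := by rw [hw0]; simp
    rw [Matrix.add_mulVec, dotProduct_add, ← Matrix.mulVec_mulVec, ← Matrix.mulVec_mulVec,
      Matrix.dotProduct_mulVec w X, Matrix.dotProduct_mulVec w Y, ← Matrix.mulVec_transpose,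
      ← Matrix.mulVec_transpose] at h1
    exact h1
  have hx : 0 ≤ (Xᵀ *ᵥ w) ⬝ᵥ (Xᵀ *ᵥ w) := Finset.sum_nonneg fun i _ => mul_self_nonneg _
  have hy : 0 ≤ (Yᵀ *ᵥ w) ⬝ᵥ (Yᵀ *ᵥ w) := Finset.sum_nonneg fun i _ => mul_self_nonneg _
  exact h w (dotProduct_self_eq_zero.mp (by linarith)) (dotProduct_self_eq_zero.mp (by linarith))

/-- The polynomial `det (X + t Y)`. -/
noncomputable def pencil {ι : Type*} [Fintype ι] [DecidableEq ι]
    (X Y : Matrix ι ι ℝ) : Polynomial ℝ :=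
  (X.map Polynomial.C + (Polynomial.X : Polynomial ℝ) • Y.map Polynomial.C).det

lemma pencil_eval {ι : Type*} [Fintype ι] [DecidableEq ι]
    (X Y : Matrix ι ι ℝ) (t : ℝ) : (pencil X Y).eval t = (X + t • Y).det := by
  unfold pencil
  rw [← Polynomial.coe_evalRingHom, RingHom.map_det]
  congr 1
  ext i j
  simp
  exact mul_comm _ _

lemma pencil_eval_I {ι : Type*} [Fintype ι] [DecidableEq ι]
    (X Y : Matrix ι ι ℝ) : (pencil X Y).eval₂ Complex.ofRealHom Complex.I =
      (X.map Complex.ofRealHom + Complex.I • Y.map Complex.ofRealHom).det := by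
  unfold pencil
  rw [← Polynomial.coe_eval₂RingHom, RingHom.map_det]
  congr 1
  ext i j
  simp
  exact mul_comm _ _

lemma pencil_ne_zero {ι : Type*} [Fintype ι] [DecidableEq ι]
    (X Y : Matrix ι ι ℝ) (h : ∀ w, Xᵀ *ᵥ w = 0 → Yᵀ *ᵥ w = 0 → w = 0)
    (hs : X * Yᵀ = Y * Xᵀ) : pencil X Y ≠ 0 := by
  intro h0
  have h1 := pencil_eval_I X Y
  rw [h0, Polynomial.eval₂_zero] at h1
  have h2 : (X.map Complex.ofRealHom + Complex.I • Y.map Complex.ofRealHom) *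
      (Xᵀ.map Complex.ofRealHom - Complex.I • Yᵀ.map Complex.ofRealHom) =
      (X * Xᵀ + Y * Yᵀ).map Complex.ofRealHom := by
    have e : (X * Yᵀ).map Complex.ofRealHom = (Y * Xᵀ).map Complex.ofRealHom := by rw [hs]
    have e3 : (X * Xᵀ + Y * Yᵀ).map Complex.ofRealHom =
      (X * Xᵀ).map Complex.ofRealHom + (Y * Yᵀ).map Complex.ofRealHom := by
      ext i j
      simp only [Matrix.map_apply, Matrix.add_apply, map_add]
    rw [e3]
    rw [Matrix.map_mul, Matrix.map_mul] at e
    rw [Matrix.map_mul, Matrix.map_mul, mul_sub, add_mul, add_mul, Matrix.mul_smul,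
      Matrix.smul_mul, Matrix.smul_mul, Matrix.mul_smul, smul_smul, Complex.I_mul_I, e]
    module
  have h3 := congrArg Matrix.det h2
  rw [Matrix.det_mul, ← h1, zero_mul] at h3
  have h4 := RingHom.map_det Complex.ofRealHom (X * Xᵀ + Y * Yᵀ)
  rw [RingHom.mapMatrix_apply, ← h3] at h4
  exact sum_gram_det_ne X Y h (by simpa using h4)

lemma symplectic_det_one {ι : Type*} [Fintype ι] [DecidableEq ι]
    (M B : Matrix ι ι ℝ) (hM : Mᵀ = -M) (hd : M.det ≠ 0) (hB : Bᵀ * M * B = M) :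
    B.det = 1 := by
  have hu : IsUnit M.det := isUnit_iff_ne_zero.mpr hd
  obtain ⟨J, hJ⟩ : ∃ J, J = M⁻¹ := ⟨_, rfl⟩
  have hMJ : M * J = 1 := by rw [hJ]; exact Matrix.mul_nonsing_inv M hu
  have hJM : J * M = 1 := by rw [hJ]; exact Matrix.nonsing_inv_mul M hu
  have hJt : Jᵀ = -J := by
    have h1 : Jᵀ * M = -1 := by
      have := congrArg Matrix.transpose hMJ
      rw [Matrix.transpose_mul, hM, Matrix.transpose_one, mul_neg] at this
      rw [← this, neg_neg]
    calc Jᵀ = Jᵀ * (M * J) := by rw [hMJ, mul_one]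
      _ = -J := by rw [← mul_assoc, h1, neg_one_mul]
  have hBJ : B * J * Bᵀ = J := by
    have h1 : (J * Bᵀ * M) * B = 1 := by
      rw [mul_assoc, mul_assoc, ← mul_assoc Bᵀ, hB, hJM]
    have h2 : B * (J * Bᵀ * M) = 1 := mul_eq_one_comm.mp h1
    calc B * J * Bᵀ = B * (J * Bᵀ * M) * J := by
          simp only [mul_assoc, hMJ, mul_one]
      _ = J := by rw [h2, one_mul]
  have hp : pencil (B + 1) ((B - 1) * J) ≠ 0 := by
    apply pencil_ne_zero
    · intro w h1 h2
      rw [Matrix.transpose_add, Matrix.transpose_one, Matrix.add_mulVec, Matrix.one_mulVec] at h1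
      rw [Matrix.transpose_mul, hJt] at h2
      have h3 : (Bᵀ - 1) *ᵥ w = 0 := by
        have := congrArg (fun z => (-M) *ᵥ z) h2
        simp only [Matrix.mulVec_mulVec, Matrix.mulVec_zero] at this
        rwa [← mul_assoc, neg_mul_neg, hMJ, one_mul, Matrix.transpose_sub,
          Matrix.transpose_one] at this
      rw [Matrix.sub_mulVec, Matrix.one_mulVec] at h3
      ext i
      have a := congrFun h1 i
      have b := congrFun h3 i
      simp only [Pi.add_apply, Pi.sub_apply, Pi.zero_apply] at a b ⊢
      linarith
    · simp only [Matrix.transpose_mul, Matrix.transpose_add, Matrix.transpose_sub,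
        Matrix.transpose_one, hJt]
      have e : B * (J * Bᵀ) = J := by rw [← mul_assoc, hBJ]
      simp only [add_mul, mul_add, sub_mul, mul_sub, neg_mul, mul_neg, one_mul, mul_one,
        mul_assoc, e]
      abel
  have hq : pencil 1 J ≠ 0 := by
    intro h0
    have := pencil_eval 1 J 0
    rw [h0] at this
    simp at this
  have hpq := mul_ne_zero hp hq
  obtain ⟨t, ht⟩ : ∃ t : ℝ, (pencil (B + 1) ((B - 1) * J) * pencil 1 J).eval t ≠ 0 := by
    by_contra! hc
    exact hpq (Polynomial.funext fun r => by rw [hc r, Polynomial.eval_zero])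
  rw [Polynomial.eval_mul, pencil_eval, pencil_eval] at ht
  obtain ⟨hZ, hU⟩ := mul_ne_zero_iff.mp ht
  have key : (1 + t • J)ᵀ * Bᵀ * M * (B + 1 + t • ((B - 1) * J)) =
      (B + 1 + t • ((B - 1) * J))ᵀ * M * (1 + t • J)ᵀ := by
    have e1 : B + 1 + t • ((B - 1) * J) = B * (1 + t • J) + (1 + t • J)ᵀ := by
      simp only [Matrix.transpose_add, Matrix.transpose_one, Matrix.transpose_smul, hJt,
        mul_add, sub_mul, one_mul, mul_one, Matrix.mul_smul]
      module
    have e2 : (1 + t • J)ᵀ * M * (1 + t • J) = (1 + t • J) * M * (1 + t • J)ᵀ := by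
      simp only [Matrix.transpose_add, Matrix.transpose_one, Matrix.transpose_smul, hJt,
        mul_add, add_mul, one_mul, mul_one, Matrix.mul_smul, Matrix.smul_mul, mul_neg, neg_mul,
        smul_neg, hMJ, hJM]
      module
    rw [e1]
    simp only [Matrix.transpose_add (B * _), Matrix.transpose_mul, Matrix.transpose_transpose]
    generalize (1 + t • J) = U at *
    calc Uᵀ * Bᵀ * M * (B * U + Uᵀ) = Uᵀ * (Bᵀ * M * B) * U + Uᵀ * Bᵀ * M * Uᵀ := by noncomm_ring
      _ = _ := by rw [hB, e2]; noncomm_ring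
  have k2 := congrArg Matrix.det key
  simp only [Matrix.det_mul, Matrix.det_transpose] at k2
  have : ((1 + t • J).det * M.det * (B + 1 + t • ((B - 1) * J)).det) * (B.det - 1) = 0 := by
    linear_combination k2
  have h5 := (mul_eq_zero.mp this).resolve_left (mul_ne_zero (mul_ne_zero hU hd) hZ)
  linarith

/-- Matrix version of the degeneracy criterion: an odd-size real matrix `A` of
determinant `1` preserving an antisymmetric matrix `Ω` of corank one fixes every
vector in the kernel of `Ω`; in particular `1` is an eigenvalue of `A`. -/
theorem matrix_fixes_kernel_of_det_one
    (n : ℕ) (hn : 1 ≤ n)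
    (Ω A : Matrix (Fin (2 * n + 1)) (Fin (2 * n + 1)) ℝ)
    (hΩ : Ωᵀ = -Ω)
    (hrank : Ω.rank = 2 * n)
    (hdet : A.det = 1)
    (hA : Aᵀ * Ω * A = Ω) :
    (∀ v : Fin (2 * n + 1) → ℝ, Ω *ᵥ v = 0 → A *ᵥ v = v) ∧
      Module.End.HasEigenvalue A.mulVecLin 1 := by
  have hker : Module.finrank ℝ (LinearMap.ker Ω.mulVecLin) = 1 := by
    have h := LinearMap.finrank_range_add_finrank_ker Ω.mulVecLin
    rw [Module.finrank_fin_fun] at h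
    unfold Matrix.rank at hrank
    omega
  obtain ⟨⟨v, hv⟩, hv0, hspan⟩ := finrank_eq_one_iff'.mp hker
  have hv1 : Ω *ᵥ v = 0 := by simpa using hv
  have hvne : v ≠ 0 := fun h => hv0 (Subtype.ext h)
  have hsp : ∀ w, Ω *ᵥ w = 0 → ∃ c : ℝ, w = c • v := by
    intro w hw
    obtain ⟨c, hc⟩ := hspan ⟨w, by simpa using hw⟩
    exact ⟨c, (congrArg Subtype.val hc).symm⟩
  have hvv : v ⬝ᵥ v ≠ 0 := fun h => hvne (dotProduct_self_eq_zero.mp h)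
  have hvΩ : ∀ w, v ⬝ᵥ (Ω *ᵥ w) = 0 := by
    intro w
    rw [Matrix.dotProduct_mulVec, ← Matrix.mulVec_transpose, hΩ, Matrix.neg_mulVec, hv1]
    simp
  have hAu : IsUnit Aᵀ.det := by rw [Matrix.det_transpose, hdet]; exact isUnit_one
  have hAinj : ∀ z, Aᵀ *ᵥ z = 0 → z = 0 := by
    intro z hz
    by_contra hne
    exact hAu.ne_zero (Matrix.exists_mulVec_eq_zero_iff.mp ⟨z, hne, hz⟩)
  obtain ⟨l, hl⟩ : ∃ l : ℝ, A *ᵥ v = l • v := by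
    apply hsp
    apply hAinj
    rw [Matrix.mulVec_mulVec, Matrix.mulVec_mulVec, hA, hv1]
  -- solve Ω w + m v = A⁻ᵀ v
  have hMdet : (Ω + Matrix.vecMulVec v v).det ≠ 0 := by
    intro h0
    obtain ⟨w, hw, hw0⟩ := Matrix.exists_mulVec_eq_zero_iff.mpr h0
    rw [Matrix.add_mulVec, Matrix.vecMulVec_mulVec, op_smul_eq_smul] at hw0
    have h1 := congrArg (fun z => v ⬝ᵥ z) hw0
    simp only [dotProduct_add, hvΩ, dotProduct_smul, dotProduct_zero, smul_eq_mul, zero_add] at h1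
    have h2 := (mul_eq_zero.mp h1).resolve_right hvv
    rw [h2, zero_smul, add_zero] at hw0
    obtain ⟨c, rfl⟩ := hsp w hw0
    rw [dotProduct_smul, smul_eq_mul] at h2
    exact hw (by rw [(mul_eq_zero.mp h2).resolve_right hvv, zero_smul])
  obtain ⟨w, m, hwm⟩ : ∃ (w : Fin (2 * n + 1) → ℝ) (m : ℝ), Aᵀ *ᵥ (Ω *ᵥ w + m • v) = v := by
    refine ⟨(Ω + Matrix.vecMulVec v v)⁻¹ *ᵥ (Aᵀ⁻¹ *ᵥ v),
      v ⬝ᵥ ((Ω + Matrix.vecMulVec v v)⁻¹ *ᵥ (Aᵀ⁻¹ *ᵥ v)), ?_⟩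
    rw [← op_smul_eq_smul, ← Matrix.vecMulVec_mulVec, ← Matrix.add_mulVec, Matrix.mulVec_mulVec _ (Ω + _),
      Matrix.mul_nonsing_inv _ (isUnit_iff_ne_zero.mpr hMdet), Matrix.one_mulVec,
      Matrix.mulVec_mulVec, Matrix.mul_nonsing_inv _ hAu, Matrix.one_mulVec]
  have hlm : l * m = 1 := by
    have h1 := congrArg (fun z => v ⬝ᵥ z) hwm
    rw [Matrix.dotProduct_mulVec, Matrix.vecMul_transpose, hl, smul_dotProduct, dotProduct_add,
      hvΩ, dotProduct_smul, smul_eq_mul, smul_eq_mul, zero_add] at h1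
    apply mul_right_cancel₀ hvv
    linarith
  have hm : m = 1 := by
    let M : Matrix (Fin (2 * n + 1) ⊕ Unit) (Fin (2 * n + 1) ⊕ Unit) ℝ :=
      Matrix.fromBlocks Ω (Matrix.replicateCol Unit v) (-Matrix.replicateRow Unit v) 0
    let B : Matrix (Fin (2 * n + 1) ⊕ Unit) (Fin (2 * n + 1) ⊕ Unit) ℝ :=
      Matrix.fromBlocks A (Matrix.replicateCol Unit w) 0 (Matrix.of fun _ _ => m)
    have hMs : Mᵀ = -M := by
      simp only [M, Matrix.fromBlocks_transpose, Matrix.fromBlocks_neg, hΩ]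
      congr 1 <;> ext i j <;> simp
    have hMd : M.det ≠ 0 := by
      intro h0
      obtain ⟨z, hz, hz0⟩ := Matrix.exists_mulVec_eq_zero_iff.mpr h0
      simp only [M, Matrix.fromBlocks_mulVec] at hz0
      have e1 : Ω *ᵥ (z ∘ Sum.inl) + z (Sum.inr ()) • v = 0 := by
        ext i
        have := congrFun hz0 (Sum.inl i)
        simpa [Matrix.mulVec, dotProduct, mul_comm] using this
      have e2 : v ⬝ᵥ (z ∘ Sum.inl) = 0 := by
        have := congrFun hz0 (Sum.inr ())
        simpa [Matrix.mulVec, dotProduct] using this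
      have h1 := congrArg (fun z => v ⬝ᵥ z) e1
      simp only [dotProduct_add, hvΩ, dotProduct_smul, dotProduct_zero, smul_eq_mul,
        zero_add] at h1
      have h2 := (mul_eq_zero.mp h1).resolve_right hvv
      rw [h2, zero_smul, add_zero] at e1
      obtain ⟨c, hc⟩ := hsp _ e1
      rw [hc, dotProduct_smul, smul_eq_mul] at e2
      rw [(mul_eq_zero.mp e2).resolve_right hvv, zero_smul] at hc
      apply hz
      ext i
      rcases i with i | i
      · exact congrFun hc i
      · exact h2
    have hBM : Bᵀ * M * B = M := by
      have hskew : (Bᵀ * M * B)ᵀ = -(Bᵀ * M * B) := by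
        simp only [Matrix.transpose_mul, Matrix.transpose_transpose, hMs]
        noncomm_ring
      have h12 : ∀ i, (Bᵀ * M * B) (Sum.inl i) (Sum.inr ()) = v i := by
        intro i
        have h := congrFun hwm i
        rw [← h, Matrix.mul_assoc]
        simp only [M, B, Matrix.fromBlocks_transpose, Matrix.fromBlocks_multiply,
          Matrix.fromBlocks_apply₁₂]
        simp [Matrix.mul_apply, Matrix.mulVec, dotProduct, mul_comm]
      ext i j
      rcases i with i | i <;> rcases j with j | j
      · have h := congrFun (congrFun hA i) j
        simp only [M, B, Matrix.fromBlocks_transpose, Matrix.fromBlocks_multiply,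
          Matrix.fromBlocks_apply₁₁]
        simpa using h
      · exact h12 i
      · have h := congrFun (congrFun hskew (Sum.inl j)) (Sum.inr ())
        rw [Matrix.transpose_apply, Matrix.neg_apply, h12] at h
        exact h
      · have h := congrFun (congrFun hskew (Sum.inr ())) (Sum.inr ())
        rw [Matrix.transpose_apply, Matrix.neg_apply] at h
        change (Bᵀ * M * B) (Sum.inr ()) (Sum.inr ()) = 0
        linarith
    have hBd := symplectic_det_one M B hMs hMd hBM
    simp only [B, Matrix.det_fromBlocks_zero₂₁, hdet, one_mul, Matrix.det_unique] at hBd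
    exact hBd
  have hl1 : l = 1 := by rw [hm, mul_one] at hlm; exact hlm
  rw [hl1, one_smul] at hl
  refine ⟨?_, ?_⟩
  · intro u hu
    obtain ⟨c, rfl⟩ := hsp u hu
    rw [Matrix.mulVec_smul, hl]
  · apply Module.End.hasEigenvalue_of_hasEigenvector (x := v)
    refine ⟨?_, hvne⟩
    rw [Module.End.mem_eigenspace_iff, one_smul]
    simpa using hl
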